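/- The following two conditions are equivalent: (1) there exists a probability measure Q on 𝒢 equivalent to P such that F is immersed in G under Q; (2) there exists a probability measure Q on 𝒢 equivalent to P such that every (F,P)-martingale is a (G,Q)-martingale. -/

import Mathlib

open MeasureTheory Set
open scoped NNReal ENNReal

noncomputable section

namespace DefaultTimes

variable {Ω : Type*}

/-- The progressively enlarged filtration
`G_t = ⋂_{u>t} (F_u ∨ σ(τ ∧ s : s ≤ u))`. -/
def enlargedFiltration {m0 : MeasurableSpace Ω}
    (F : Filtration ℝ≥0 m0) (τ : Ω → ℝ≥0∞) (hτ : Measurable τ) :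
    Filtration ℝ≥0 m0 where
  seq t := ⨅ u ∈ Set.Ioi t, (F u ⊔ ⨆ s ∈ Set.Iic u,
      MeasurableSpace.comap (fun ω => min (τ ω) (s : ℝ≥0∞)) inferInstance)
  mono' := fun i j hij => le_iInf₂ fun u hu => iInf₂_le u (lt_of_le_of_lt hij hu)
  le' := fun t => by
    refine le_trans (iInf₂_le (t + 1) (lt_add_of_pos_right t one_pos)) ?_
    exact sup_le (Filtration.le _ _)
      (iSup₂_le fun s _ => Measurable.comap_le (hτ.min measurable_const))

/-- `F` is immersed in `G` under `μ` ((H)-hypothesis): every `(F,μ)`-martingale is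
a `(G,μ)`-martingale. -/
def Immersion {m0 : MeasurableSpace Ω} (F G : Filtration ℝ≥0 m0) (μ : Measure Ω) : Prop :=
  ∀ f : ℝ≥0 → Ω → ℝ, Martingale f F μ → Martingale f G μ

theorem le_enlargedFiltration {m0 : MeasurableSpace Ω}
    (F : Filtration ℝ≥0 m0) (τ : Ω → ℝ≥0∞) (hτ : Measurable τ) :
    F ≤ enlargedFiltration F τ hτ :=
  fun _ => le_iInf₂ fun _ hu => (F.mono (le_of_lt hu)).trans le_sup_left

/-- A strongly adapted integrable process with constant integrals over past events is a
martingale. -/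
theorem martingale_of_setIntegral_eq {m0 : MeasurableSpace Ω} {μ : Measure Ω} [IsFiniteMeasure μ]
    {H : Filtration ℝ≥0 m0} {f : ℝ≥0 → Ω → ℝ} (hf : StronglyAdapted H f)
    (hint : ∀ i, Integrable (f i) μ)
    (h : ∀ i j, i ≤ j → ∀ s, MeasurableSet[H i] s → ∫ x in s, f i x ∂μ = ∫ x in s, f j x ∂μ) :
    Martingale f H μ :=
  ⟨hf, fun i j hij => (ae_eq_condExp_of_forall_setIntegral_eq (H.le i) (hint j)
    (fun _ _ _ => (hint i).integrableOn) (fun s hs _ => h i j hij s hs)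
    (hf i).aestronglyMeasurable).symm⟩

theorem trim_restrict_congr {m m0 : MeasurableSpace Ω} {μ ν : Measure Ω} {hm : m ≤ m0}
    (h : μ.trim hm = ν.trim hm) {s : Set Ω} (hs : MeasurableSet[m] s) :
    (μ.restrict s).trim hm = (ν.restrict s).trim hm := by
  rw [← restrict_trim hm μ hs, ← restrict_trim hm ν hs, h]

theorem integral_eq_of_trim_eq {m m0 : MeasurableSpace Ω} {μ ν : Measure Ω} {hm : m ≤ m0}
    (h : μ.trim hm = ν.trim hm) {f : Ω → ℝ} (hf : StronglyMeasurable[m] f) :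
    ∫ x, f x ∂μ = ∫ x, f x ∂ν := by
  rw [integral_trim hm hf, integral_trim hm hf, h]

theorem integrable_of_trim_eq {m m0 : MeasurableSpace Ω} {μ ν : Measure Ω} {hm : m ≤ m0}
    (h : μ.trim hm = ν.trim hm) {f : Ω → ℝ} (hf : StronglyMeasurable[m] f)
    (hi : Integrable f μ) : Integrable f ν := by
  have h1 := hi.trim hm hf
  rw [h] at h1
  exact integrable_of_integrable_trim hm h1

/-- The martingale property only depends on the measure through its restrictions to the
σ-algebras of the filtration. -/
theorem martingale_of_trim_eq {m0 : MeasurableSpace Ω} {μ ν : Measure Ω} [IsFiniteMeasure μ]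
    [IsFiniteMeasure ν] {H : Filtration ℝ≥0 m0} (h : ∀ t, μ.trim (H.le t) = ν.trim (H.le t))
    {f : ℝ≥0 → Ω → ℝ} (hf : Martingale f H μ) : Martingale f H ν := by
  refine martingale_of_setIntegral_eq hf.1
    (fun i => integrable_of_trim_eq (h i) (hf.1 i) (hf.integrable i)) fun i j hij s hs => ?_
  rw [← integral_eq_of_trim_eq (trim_restrict_congr (h i) hs) (hf.1 i),
    ← integral_eq_of_trim_eq (trim_restrict_congr (h j) (H.mono hij s hs)) (hf.1 j)]
  exact hf.setIntegral_eq hij hs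

/-- A measure `Q` equivalent to `P` can be given an `m`-measurable density so as to coincide with
`P` on `m`. -/
theorem exists_withDensity_trim_eq {m m0 : MeasurableSpace Ω} (hm : m ≤ m0) {P Q : Measure Ω}
    [IsProbabilityMeasure P] [IsProbabilityMeasure Q] (hQP : Q ≪ P) (hPQ : P ≪ Q) :
    ∃ z : Ω → ℝ≥0, Measurable[m] z ∧
      IsProbabilityMeasure (Q.withDensity fun x => (z x : ℝ≥0∞)) ∧
      Q ≪ Q.withDensity (fun x => (z x : ℝ≥0∞)) ∧
      (Q.withDensity fun x => (z x : ℝ≥0∞)).trim hm = P.trim hm := by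
  have hPQ' := hPQ.trim hm
  have hQP' := hQP.trim hm
  have hmeas : Measurable[m] ((P.trim hm).rnDeriv (Q.trim hm)) := Measure.measurable_rnDeriv _ _
  have hz : Measurable[m] fun x => ((P.trim hm).rnDeriv (Q.trim hm) x).toNNReal :=
    hmeas.ennreal_toNNReal
  have heq : (fun x => ((((P.trim hm).rnDeriv (Q.trim hm) x).toNNReal : ℝ≥0) : ℝ≥0∞))
      =ᵐ[Q.trim hm] (P.trim hm).rnDeriv (Q.trim hm) :=
    coe_toNNReal_ae_eq (Measure.rnDeriv_lt_top _ _)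
  have htrim : (Q.withDensity fun x =>
      ((((P.trim hm).rnDeriv (Q.trim hm) x).toNNReal : ℝ≥0) : ℝ≥0∞)).trim hm = P.trim hm := by
    refine @Measure.ext _ m _ _ fun s hs => ?_
    rw [trim_measurableSet_eq hm hs, withDensity_apply _ (hm s hs),
      ← lintegral_trim (μ := Q.restrict s) hm hz.coe_nnreal_ennreal, ← restrict_trim hm Q hs,
      lintegral_congr_ae (ae_restrict_of_ae heq), Measure.setLIntegral_rnDeriv hPQ']
  refine ⟨_, hz, ⟨?_⟩, ?_, htrim⟩
  · rw [← trim_measurableSet_eq hm MeasurableSet.univ, htrim,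
      trim_measurableSet_eq hm MeasurableSet.univ, measure_univ]
  · refine withDensity_absolutelyContinuous' ((hz.mono hm le_rfl).coe_nnreal_ennreal.aemeasurable)
      (ae_of_ae_trim hm ?_)
    filter_upwards [heq, hQP'.ae_le (Measure.rnDeriv_pos hPQ')] with x hx hpos
    rw [hx]
    exact hpos.ne'

/-- Under immersion, conditioning an `F_∞`-measurable variable on `G_t` or on `F_t` is the same. -/
theorem Immersion.setIntegral_condExp_eq {m0 : MeasurableSpace Ω} {F G : Filtration ℝ≥0 m0}
    {μ : Measure Ω} [IsFiniteMeasure μ] (h : Immersion F G μ) {X : Ω → ℝ}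
    (hX : StronglyMeasurable[⨆ t, F t] X) (hi : Integrable X μ) (t : ℝ≥0) {s : Set Ω}
    (hs : MeasurableSet[G t] s) : ∫ x in s, X x ∂μ = ∫ x in s, (μ[X | F t]) x ∂μ := by
  let H : Filtration ℕ m0 :=
    ⟨fun n => F (n : ℝ≥0), fun a b hab => F.mono (Nat.cast_le.2 hab), fun n => F.le _⟩
  have hle : (⨆ t, F t) ≤ ⨆ n, H n := iSup_le fun t => by
    obtain ⟨n, hn⟩ := exists_nat_ge t
    exact (F.mono hn).trans (le_iSup (fun n => H n) n)
  have hlim := tendsto_setIntegral_of_L1' X hi.aestronglyMeasurable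
    (Filter.Eventually.of_forall fun n => integrable_condExp)
    (hi.tendsto_eLpNorm_condExp (ℱ := H) (hX.mono hle)) s
  refine tendsto_nhds_unique hlim (tendsto_const_nhds.congr' ?_)
  obtain ⟨N, hN⟩ := exists_nat_ge t
  filter_upwards [Filter.eventually_ge_atTop N] with n hn
  exact (h _ (martingale_condExp X F μ)).setIntegral_eq
    (hN.trans (Nat.cast_le.2 hn) : t ≤ (n : ℝ≥0)) hs

/-- If `F` is immersed in `G` under `Q` and `z` is an `F_∞`-measurable density, then `F` is immersed
in `G` under `z • Q`. -/
theorem Immersion.withDensity {m0 : MeasurableSpace Ω} {F G : Filtration ℝ≥0 m0} (hFG : F ≤ G)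
    {Q : Measure Ω} [IsFiniteMeasure Q] (h : Immersion F G Q) {z : Ω → ℝ≥0}
    (hz : Measurable[⨆ t, F t] z) [IsFiniteMeasure (Q.withDensity fun x => (z x : ℝ≥0∞))] :
    Immersion F G (Q.withDensity fun x => (z x : ℝ≥0∞)) := by
  intro f hf
  have hz0 : Measurable z := hz.mono (iSup_le F.le) le_rfl
  have hint : ∀ t, Integrable (fun x => z x • f t x) Q := fun t =>
    (integrable_withDensity_iff_integrable_smul hz0).1 (hf.integrable t)
  have hsm : ∀ t, StronglyMeasurable[⨆ t, F t] (fun x => z x • f t x) := fun t =>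
    hz.stronglyMeasurable.smul ((hf.1 t).mono (le_iSup (fun t => F t) t))
  refine martingale_of_setIntegral_eq (fun t => (hf.1 t).mono (hFG t)) hf.integrable
    fun i j hij s hs => ?_
  have hcond : Q[fun x => z x • f i x | F i] =ᵐ[Q] Q[fun x => z x • f j x | F i] := by
    refine ae_eq_condExp_of_forall_setIntegral_eq (F.le i) (hint j)
      (fun _ _ _ => integrable_condExp.integrableOn) (fun A hA _ => ?_)
      stronglyMeasurable_condExp.aestronglyMeasurable
    rw [setIntegral_condExp (F.le i) (hint i) hA,
      ← setIntegral_withDensity_eq_setIntegral_smul hz0 _ (F.le i A hA),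
      ← setIntegral_withDensity_eq_setIntegral_smul hz0 _ (F.le i A hA)]
    exact hf.setIntegral_eq hij hA
  rw [setIntegral_withDensity_eq_setIntegral_smul hz0 _ (G.le i s hs),
    setIntegral_withDensity_eq_setIntegral_smul hz0 _ (G.le i s hs),
    h.setIntegral_condExp_eq (hsm i) (hint i) i hs, h.setIntegral_condExp_eq (hsm j) (hint j) i hs]
  exact integral_congr_ae (ae_restrict_of_ae hcond)

/-- A martingale stays a martingale after a change of measure with a density known at time `0`. -/
theorem martingale_withDensity {m0 : MeasurableSpace Ω} {G : Filtration ℝ≥0 m0}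
    {Q : Measure Ω} [IsFiniteMeasure Q] {z : Ω → ℝ≥0} (hz : Measurable[G 0] z)
    [IsFiniteMeasure (Q.withDensity fun x => (z x : ℝ≥0∞))] {f : ℝ≥0 → Ω → ℝ}
    (hf : Martingale f G Q)
    (hint : ∀ t, Integrable (f t) (Q.withDensity fun x => (z x : ℝ≥0∞))) :
    Martingale f G (Q.withDensity fun x => (z x : ℝ≥0∞)) := by
  have hz0 : Measurable z := hz.mono (G.le 0) le_rfl
  have hint' : ∀ t, Integrable ((fun x => (z x : ℝ)) * f t) Q := fun t =>
    (integrable_withDensity_iff_integrable_smul hz0).1 (hint t)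
  refine martingale_of_setIntegral_eq hf.1 hint fun i j hij s hs => ?_
  have hsm : StronglyMeasurable[G i] fun x => (z x : ℝ) :=
    (hz.mono (G.mono zero_le) le_rfl).coe_nnreal_real.stronglyMeasurable
  have hpull : Q[(fun x => (z x : ℝ)) * f j | G i] =ᵐ[Q] (fun x => (z x : ℝ)) * f i :=
    (condExp_mul_of_stronglyMeasurable_left hsm (hint' j) (hf.integrable j)).trans
      (Filter.EventuallyEq.rfl.mul (hf.2 i j hij))
  rw [setIntegral_withDensity_eq_setIntegral_smul hz0 _ (G.le i s hs),
    setIntegral_withDensity_eq_setIntegral_smul hz0 _ (G.le i s hs)]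
  exact (integral_congr_ae (ae_restrict_of_ae hpull)).symm.trans
    (setIntegral_condExp (G.le i) (hint' j) hs)

/-- If `(F,P)`-martingales are `(G,Q)`-martingales and the `F_0`-measurable density `z` makes
`z • Q` agree with `P` on `F_0`, then `z • Q` agrees with `P` on every `F_t`. -/
theorem trim_withDensity_eq {m0 : MeasurableSpace Ω} {F G : Filtration ℝ≥0 m0} (hFG : F ≤ G)
    {P Q : Measure Ω} [IsProbabilityMeasure P] [IsProbabilityMeasure Q]
    (h : ∀ f : ℝ≥0 → Ω → ℝ, Martingale f F P → Martingale f G Q) {z : Ω → ℝ≥0}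
    (hz : Measurable[F 0] z) [IsProbabilityMeasure (Q.withDensity fun x => (z x : ℝ≥0∞))]
    (h0 : (Q.withDensity fun x => (z x : ℝ≥0∞)).trim (F.le 0) = P.trim (F.le 0)) (t : ℝ≥0) :
    (Q.withDensity fun x => (z x : ℝ≥0∞)).trim (F.le t) = P.trim (F.le t) := by
  refine @Measure.ext _ (F t) _ _ fun A hA => ?_
  rw [trim_measurableSet_eq _ hA, trim_measurableSet_eq _ hA]
  have hz0 : Measurable z := hz.mono (F.le 0) le_rfl
  have hzG : StronglyMeasurable[G 0] fun x => (z x : ℝ) :=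
    (hz.mono (hFG 0) le_rfl).coe_nnreal_real.stronglyMeasurable
  have hA0 : MeasurableSet A := F.le t A hA
  let X : Ω → ℝ := A.indicator fun _ => 1
  have hXm : StronglyMeasurable[F t] X := stronglyMeasurable_const.indicator hA
  have hX : ∀ (μ : Measure Ω) [IsFiniteMeasure μ], Integrable X μ := fun μ _ =>
    (integrable_const 1).indicator hA0
  have hM := h _ (martingale_condExp X F P)
  have hXt : P[X | F t] = X := condExp_of_stronglyMeasurable (F.le t) hXm (hX P)
  have hzX : Integrable ((fun x => (z x : ℝ)) * X) Q :=
    (integrable_withDensity_iff_integrable_smul hz0).1 (hX _)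
  have hstep : Q[X | G 0] =ᵐ[Q] P[X | F 0] := by
    have := hM.2 0 t zero_le
    simp only [hXt] at this
    exact this
  have hpull : Q[(fun x => (z x : ℝ)) * X | G 0] =ᵐ[Q] (fun x => (z x : ℝ)) * P[X | F 0] :=
    (condExp_mul_of_stronglyMeasurable_left hzG hzX (hX Q)).trans
      (Filter.EventuallyEq.rfl.mul hstep)
  have key : ∫ x, X x ∂(Q.withDensity fun x => (z x : ℝ≥0∞)) = ∫ x, X x ∂P := by
    rw [← integral_condExp (F.le 0) (f := X) (μ := P),
      ← integral_eq_of_trim_eq h0 stronglyMeasurable_condExp,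
      integral_withDensity_eq_integral_smul hz0, integral_withDensity_eq_integral_smul hz0]
    exact (integral_condExp (G.le 0)).symm.trans (integral_congr_ae hpull)
  simpa [X, integral_indicator hA0, Measure.real, ENNReal.toReal_eq_toReal_iff'] using key

theorem stmt_6 {m0 : MeasurableSpace Ω} (P : Measure Ω) [IsProbabilityMeasure P]
    (F : Filtration ℝ≥0 m0) (τ : Ω → ℝ≥0∞) (hτ : Measurable τ) :
    (∃ Q : Measure Ω, IsProbabilityMeasure Q ∧ Q ≪ P ∧ P ≪ Q ∧
        Immersion F (enlargedFiltration F τ hτ) Q) ↔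
      ∃ Q : Measure Ω, IsProbabilityMeasure Q ∧ Q ≪ P ∧ P ≪ Q ∧
        ∀ f : ℝ≥0 → Ω → ℝ, Martingale f F P → Martingale f (enlargedFiltration F τ hτ) Q := by
  have hFG := le_enlargedFiltration F τ hτ
  constructor
  · rintro ⟨Q, _, hQP, hPQ, hQ⟩
    have hle : (⨆ t, F t) ≤ m0 := iSup_le F.le
    obtain ⟨z, hz, _, hac, htrim⟩ := exists_withDensity_trim_eq hle hQP hPQ
    refine ⟨_, inferInstance, (withDensity_absolutelyContinuous _ _).trans hQP, hPQ.trans hac,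
      fun f hf => hQ.withDensity hFG hz f (martingale_of_trim_eq (fun t => ?_) hf)⟩
    have hFt : F t ≤ ⨆ t, F t := le_iSup (fun t => F t) t
    rw [← trim_trim (hm₁₂ := hFt) (hm₂ := hle), ← htrim, trim_trim]
  · rintro ⟨Q, _, hQP, hPQ, hQ⟩
    obtain ⟨z, hz, _, hac, htrim⟩ := exists_withDensity_trim_eq (F.le 0) hQP hPQ
    refine ⟨_, inferInstance, (withDensity_absolutelyContinuous _ _).trans hQP, hPQ.trans hac,
      fun f hf => martingale_withDensity (hz.mono (hFG 0) le_rfl)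
        (hQ f (martingale_of_trim_eq (trim_withDensity_eq hFG hQ hz htrim) hf)) hf.integrable⟩

end DefaultTimes
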